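/- arXiv:2110.01046 — 2 statements merged into one kernel-verified Lean document; each statement's English description precedes it below -/
import Mathlib

section
/- (Slepian's inequality.) Let n ≥ 1 and let U = (U₁, …, Uₙ) and V = (V₁, …, Vₙ) be centered Gaussian random vectors (possibly on different probability spaces) such that E[Uⱼ²] = E[Vⱼ²] for all 1 ≤ j ≤ n and E[UᵢUⱼ] ≤ E[VᵢVⱼ] for all 1 ≤ i, j ≤ n. Then for every r ∈ ℝ, P(max_{1≤j≤n} Uⱼ ≥ r) ≥ P(max_{1≤j≤n} Vⱼ ≥ r). -/
open Filter Set Topology MeasureTheory ProbabilityTheory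

/-- **Stein's lemma** for a centered real Gaussian measure. -/
theorem integral_mul_gaussianReal_eq {v : NNReal} {f f' : ℝ → ℝ} {C C' : ℝ}
    (hf : ∀ x, HasDerivAt f (f' x) x) (hC : ∀ x, |f x| ≤ C) (hC' : ∀ x, |f' x| ≤ C') :
    ∫ x, x * f x ∂gaussianReal 0 v = v * ∫ x, f' x ∂gaussianReal 0 v := by
  by_cases hv : v = 0
  · simp [hv]
  have hv' : (v : ℝ) ≠ 0 := by exact_mod_cast hv
  have hfm : Measurable f :=
    (continuous_iff_continuousAt.2 fun x ↦ (hf x).continuousAt).measurable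
  have hfm' : Measurable f' := by
    rw [show f' = deriv f from funext fun x ↦ (hf x).deriv.symm]
    exact measurable_deriv f
  have hp (x : ℝ) : HasDerivAt (gaussianPDFReal 0 v) (-(x / v) * gaussianPDFReal 0 v x) x := by
    rw [gaussianPDFReal_def]
    have h := ((((hasDerivAt_id x).sub_const 0).pow 2).neg.div_const (2 * (v : ℝ))).exp.const_mul
      (√(2 * Real.pi * v))⁻¹
    refine h.congr_deriv ?_
    simp
    field_simp
  have hpi : Integrable (gaussianPDFReal 0 v) := integrable_gaussianPDFReal 0 v
  have hxp : Integrable (fun x ↦ x * gaussianPDFReal 0 v x) := by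
    have h : Integrable (fun x : ℝ ↦ x) (gaussianReal 0 v) :=
      (memLp_id_gaussianReal' 1 (by simp)).integrable le_rfl
    rw [gaussianReal_of_var_ne_zero _ hv, integrable_withDensity_iff (measurable_gaussianPDF _ _)
      (ae_of_all _ fun _ ↦ gaussianPDF_lt_top)] at h
    simpa using h
  have key := integral_mul_deriv_eq_deriv_mul_of_integrable (u := f) (u' := f')
    (v := gaussianPDFReal 0 v) (v' := fun x ↦ -(x / v) * gaussianPDFReal 0 v x)
    (fun x _ ↦ hf x) (fun x _ ↦ hp x) ?_ ?_ ?_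
  · rw [integral_gaussianReal_eq_integral_smul hv, integral_gaussianReal_eq_integral_smul hv]
    simp only [smul_eq_mul]
    have h1 : ∫ x, gaussianPDFReal 0 v x * (x * f x)
        = -(v : ℝ) * ∫ x, f x * (-(x / v) * gaussianPDFReal 0 v x) := by
      rw [← integral_const_mul]
      congr 1 with x
      field_simp
    rw [h1, key, neg_mul_neg]
    simp_rw [mul_comm]
  · refine ((hxp.const_mul (-(v : ℝ)⁻¹)).bdd_mul hfm.aestronglyMeasurable
      (ae_of_all _ hC)).congr (ae_of_all _ fun x ↦ ?_)
    simp only [Pi.mul_apply]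
    ring
  · exact hpi.bdd_mul hfm'.aestronglyMeasurable (ae_of_all _ hC')
  · exact hpi.bdd_mul hfm.aestronglyMeasurable (ae_of_all _ hC)

theorem covariance_eq_zero_of_variance_eq_zero {Ω : Type*} [MeasurableSpace Ω] {P : Measure Ω}
    [IsProbabilityMeasure P] {X Y : Ω → ℝ} (hX : MemLp X 2 P) (hX0 : Var[X; P] = 0) :
    cov[X, Y; P] = 0 := by
  have hint : Integrable (fun ω ↦ (X ω - P[X]) ^ 2) P := (hX.sub (memLp_const _)).integrable_sq
  rw [variance_eq_integral hX.aestronglyMeasurable.aemeasurable,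
    integral_eq_zero_iff_of_nonneg (fun ω ↦ sq_nonneg _) hint] at hX0
  rw [covariance]
  refine integral_eq_zero_of_ae ?_
  filter_upwards [hX0] with ω hω
  simp [pow_eq_zero_iff two_ne_zero |>.1 hω]

/-- **Gaussian integration by parts**: if `(W, Z)` is a Gaussian vector and `W` is centered, then
`E[W f(Z)] = ∑ j, Cov(W, Z j) E[∂ⱼ f(Z)]`. -/
theorem integral_mul_comp_eq_sum_covariance {Ω ι : Type*} [Fintype ι] [MeasurableSpace Ω]
    {P : Measure Ω} {W : Ω → ℝ} {Z : ι → Ω → ℝ}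
    (hWZ : HasGaussianLaw (fun ω ↦ (W ω, fun j ↦ Z j ω)) P) (hW : P[W] = 0)
    {f : (ι → ℝ) → ℝ} {f' : ι → (ι → ℝ) → ℝ} {C C' : ℝ}
    (hf : ∀ x, HasFDerivAt f
      (∑ j, f' j x • ContinuousLinearMap.proj (R := ℝ) (φ := fun _ : ι ↦ ℝ) j) x)
    (hf' : ∀ j, Continuous (f' j)) (hC : ∀ x, |f x| ≤ C) (hC' : ∀ j x, |f' j x| ≤ C') :
    ∫ ω, W ω * f (fun j ↦ Z j ω) ∂P
      = ∑ j, cov[W, Z j; P] * ∫ ω, f' j (fun j ↦ Z j ω) ∂P := by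
  have : IsProbabilityMeasure P := hWZ.isProbabilityMeasure
  have hfc : Continuous f := continuous_iff_continuousAt.2 fun x ↦ (hf x).continuousAt
  have hWg : HasGaussianLaw W P := hWZ.fst
  have hZg (j : ι) : HasGaussianLaw (Z j) P := hWZ.snd.eval j
  set d : ι → ℝ := fun j ↦ cov[W, Z j; P] / Var[W; P] with hd
  have hdv (j : ι) : d j * Var[W; P] = cov[W, Z j; P] := by
    by_cases h : Var[W; P] = 0
    · rw [h, mul_zero, covariance_eq_zero_of_variance_eq_zero hWg.memLp_two h]
    · exact div_mul_cancel₀ _ h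
  set R : ι → Ω → ℝ := fun j ω ↦ Z j ω - d j * W ω with hR
  have hWR : IndepFun W (fun ω j ↦ R j ω) P := by
    have hG : HasGaussianLaw (fun ω ↦ (fun _ : Unit ↦ W ω, fun j ↦ R j ω)) P :=
      hWZ.map_fun ((ContinuousLinearMap.pi fun _ : Unit ↦ .fst ℝ ℝ (ι → ℝ)).prod
        (.pi fun j ↦ .proj j ∘L .snd ℝ ℝ (ι → ℝ) - d j • .fst ℝ ℝ (ι → ℝ)))
    have h := hG.indepFun_of_covariance_eval (X := fun _ ↦ W) (Y := R) fun _ j ↦ by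
      rw [hR, covariance_fun_sub_right hWg.memLp_two (hZg j).memLp_two
        (hWg.memLp_two.const_mul _), covariance_const_mul_right, covariance_self
        hWg.aemeasurable, hdv, sub_self]
    exact h.comp (measurable_pi_apply ()) measurable_id
  have hRm : AEMeasurable (fun ω j ↦ R j ω) P := aemeasurable_pi_lambda _ fun j ↦
    (hZg j).aemeasurable.sub (hWg.aemeasurable.const_mul _)
  have hlaw : P.map (fun ω ↦ (W ω, fun j ↦ R j ω))
      = (gaussianReal 0 Var[W; P].toNNReal).prod (P.map fun ω j ↦ R j ω) := by
    rw [(indepFun_iff_map_prod_eq_prod_map_map hWg.aemeasurable hRm).1 hWR,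
      hWg.map_eq_gaussianReal, hW]
  have : IsProbabilityMeasure (P.map fun ω j ↦ R j ω) := Measure.isProbabilityMeasure_map hRm
  set γ := gaussianReal 0 Var[W; P].toNNReal
  set ρ := P.map fun ω j ↦ R j ω
  have hsplit {g : ℝ × (ι → ℝ) → ℝ} (hg : Continuous g) :
      ∫ ω, g (W ω, fun j ↦ R j ω) ∂P = ∫ p, g p ∂(γ.prod ρ) := by
    rw [← hlaw, integral_map (hWg.aemeasurable.prodMk hRm) hg.aestronglyMeasurable]
  have hZ (ω : Ω) : (fun j ↦ Z j ω) = (fun j ↦ R j ω) + W ω • d := by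
    ext j; simp [hR, mul_comm]
  have hbdd {g : (ι → ℝ) → ℝ} (hg : Continuous g) {K : ℝ} (hK : ∀ x, |g x| ≤ K) :
      Integrable (fun p : ℝ × (ι → ℝ) ↦ g (p.2 + p.1 • d)) (γ.prod ρ) :=
    Integrable.of_bound (by fun_prop) K (ae_of_all _ fun p ↦ hK _)
  have hint : Integrable (fun p : ℝ × (ι → ℝ) ↦ p.1 * f (p.2 + p.1 • d)) (γ.prod ρ) := by
    have h : Integrable (fun x : ℝ ↦ x) γ := (memLp_id_gaussianReal' 1 (by simp)).integrable le_rfl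
    exact (h.comp_fst ρ).mul_bdd (c := C) (by fun_prop) (ae_of_all _ fun p ↦ hC _)
  have hstein (y : ι → ℝ) : ∫ x, x * f (y + x • d) ∂γ
      = ∑ j, cov[W, Z j; P] * ∫ x, f' j (y + x • d) ∂γ := by
    rw [integral_mul_gaussianReal_eq (f' := fun x ↦ ∑ j, d j * f' j (y + x • d))
      (C := C) (C' := ∑ j, |d j| * C'), integral_finsetSum, Finset.mul_sum,
      Real.coe_toNNReal _ (variance_nonneg _ _)]
    · refine Finset.sum_congr rfl fun j _ ↦ ?_
      rw [integral_const_mul, ← hdv j]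
      ring
    · intro j _
      exact (Integrable.of_bound (((hf' j).comp (by fun_prop)).aestronglyMeasurable) C'
        (ae_of_all _ fun x ↦ hC' j _)).const_mul _
    · intro x
      have h1 : HasDerivAt (fun x : ℝ ↦ y + x • d) d x := by
        simpa using ((hasDerivAt_id x).smul_const d).const_add y
      have h2 := (hf (y + x • d)).comp_hasDerivAt x h1
      simpa [mul_comm, Function.comp_def] using h2
    · exact fun x ↦ hC _
    · intro x
      refine (Finset.abs_sum_le_sum_abs _ _).trans (Finset.sum_le_sum fun j _ ↦ ?_)
      rw [abs_mul]
      exact mul_le_mul_of_nonneg_left (hC' j _) (abs_nonneg _)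
  simp_rw [hZ]
  rw [hsplit (g := fun p ↦ p.1 * f (p.2 + p.1 • d)) (by fun_prop), integral_prod_symm _ hint]
  simp_rw [hstein]
  rw [integral_finsetSum]
  · refine Finset.sum_congr rfl fun j _ ↦ ?_
    rw [integral_const_mul, hsplit (g := fun p ↦ f' j (p.2 + p.1 • d))
      ((hf' j).comp (by fun_prop)), integral_prod_symm _ (hbdd (hf' j) (hC' j))]
  · exact fun j _ ↦ (hbdd (hf' j) (hC' j)).integral_prod_right.const_mul _

/-- Gaussian comparison by interpolation: if `X` and `Y` are uncorrelated centered Gaussian vectors,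
jointly Gaussian, with equal variances and the covariances of `X` dominated by those of `Y`, then
`E[f(X)] ≤ E[f(Y)]` for every `f` whose mixed second derivatives are nonnegative. -/
theorem integral_comp_le_integral_comp_of_covariance_le {Ω ι : Type*} [Fintype ι]
    [MeasurableSpace Ω] {P : Measure Ω} {X Y : ι → Ω → ℝ}
    (hXY : HasGaussianLaw (fun ω ↦ ((fun j ↦ X j ω, fun j ↦ Y j ω) : (ι → ℝ) × (ι → ℝ))) P)
    (hX : ∀ j, P[X j] = 0) (hY : ∀ j, P[Y j] = 0) (hcross : ∀ i j, cov[X i, Y j; P] = 0)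
    (hvar : ∀ j, cov[X j, X j; P] = cov[Y j, Y j; P])
    (hcov : ∀ i j, cov[X i, X j; P] ≤ cov[Y i, Y j; P])
    {f : (ι → ℝ) → ℝ} {f' : ι → (ι → ℝ) → ℝ} {f'' : ι → ι → (ι → ℝ) → ℝ} {C : ℝ}
    (hf : ∀ x, HasFDerivAt f
      (∑ i, f' i x • ContinuousLinearMap.proj (R := ℝ) (φ := fun _ : ι ↦ ℝ) i) x)
    (hf' : ∀ i x, HasFDerivAt (f' i)
      (∑ j, f'' i j x • ContinuousLinearMap.proj (R := ℝ) (φ := fun _ : ι ↦ ℝ) j) x)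
    (hf'' : ∀ i j, Continuous (f'' i j)) (hC : ∀ x, |f x| ≤ C) (hC' : ∀ i x, |f' i x| ≤ C)
    (hC'' : ∀ i j x, |f'' i j x| ≤ C) (hnonneg : ∀ i j, i ≠ j → ∀ x, 0 ≤ f'' i j x) :
    ∫ ω, f (fun j ↦ X j ω) ∂P ≤ ∫ ω, f (fun j ↦ Y j ω) ∂P := by
  have : IsProbabilityMeasure P := hXY.isProbabilityMeasure
  have hXg (j : ι) : HasGaussianLaw (X j) P := hXY.fst.eval j
  have hYg (j : ι) : HasGaussianLaw (Y j) P := hXY.snd.eval j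
  have hfc : Continuous f := continuous_iff_continuousAt.2 fun x ↦ (hf x).continuousAt
  have hfc' (i : ι) : Continuous (f' i) :=
    continuous_iff_continuousAt.2 fun x ↦ (hf' i x).continuousAt
  set Z : ℝ → ι → Ω → ℝ := fun θ j ω ↦ Real.cos θ * X j ω + Real.sin θ * Y j ω with hZ
  set W : ℝ → ι → Ω → ℝ := fun θ j ω ↦ -Real.sin θ * X j ω + Real.cos θ * Y j ω with hW
  have hZm (θ : ℝ) : AEMeasurable (fun ω j ↦ Z θ j ω) P := aemeasurable_pi_lambda _ fun j ↦
    ((hXg j).aemeasurable.const_mul _).add ((hYg j).aemeasurable.const_mul _)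
  have hWm (θ : ℝ) (j : ι) : AEMeasurable (W θ j) P :=
    ((hXg j).aemeasurable.const_mul _).add ((hYg j).aemeasurable.const_mul _)
  have hderiv (θ : ℝ) : HasDerivAt (fun θ ↦ ∫ ω, f (fun j ↦ Z θ j ω) ∂P)
      (∫ ω, ∑ i, W θ i ω * f' i (fun j ↦ Z θ j ω) ∂P) θ := by
    refine (hasDerivAt_integral_of_dominated_loc_of_deriv_le (s := univ)
      (F' := fun θ ω ↦ ∑ i, W θ i ω * f' i (fun j ↦ Z θ j ω))
      (bound := fun ω ↦ ∑ i, (|X i ω| + |Y i ω|) * C) univ_mem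
      (.of_forall fun θ ↦ (hfc.measurable.comp_aemeasurable (hZm θ)).aestronglyMeasurable)
      ?_ ?_ ?_ ?_ ?_).2
    · exact Integrable.of_bound (hfc.measurable.comp_aemeasurable (hZm θ)).aestronglyMeasurable C
        (ae_of_all _ fun ω ↦ hC _)
    · exact (Finset.aemeasurable_fun_sum _ fun i _ ↦ (hWm θ i).mul
        ((hfc' i).measurable.comp_aemeasurable (hZm θ))).aestronglyMeasurable
    · refine ae_of_all _ fun ω t _ ↦ (Finset.abs_sum_le_sum_abs _ _).trans
        (Finset.sum_le_sum fun i _ ↦ ?_)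
      rw [abs_mul]
      refine mul_le_mul ?_ (hC' i _) (abs_nonneg _) (by positivity)
      refine (abs_add_le _ _).trans (add_le_add ?_ ?_) <;> rw [abs_mul]
      · rw [abs_neg]
        exact mul_le_of_le_one_left (abs_nonneg _) (Real.abs_sin_le_one t)
      · exact mul_le_of_le_one_left (abs_nonneg _) (Real.abs_cos_le_one t)
    · exact integrable_finsetSum _ fun i _ ↦
        ((hXg i).integrable.abs.add (hYg i).integrable.abs).mul_const C
    · refine ae_of_all _ fun ω t _ ↦ ?_
      have h1 : HasDerivAt (fun t j ↦ Z t j ω) (fun j ↦ W t j ω) t := hasDerivAt_pi.2 fun j ↦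
        ((Real.hasDerivAt_cos t).mul_const _).add ((Real.hasDerivAt_sin t).mul_const _)
      have h2 := (hf _).comp_hasDerivAt t h1
      simpa [mul_comm, Function.comp_def] using h2
  have hibp (θ : ℝ) : ∫ ω, ∑ i, W θ i ω * f' i (fun j ↦ Z θ j ω) ∂P
      = ∑ i, ∑ j, cov[W θ i, Z θ j; P] * ∫ ω, f'' i j (fun j ↦ Z θ j ω) ∂P := by
    rw [integral_finsetSum]
    · refine Finset.sum_congr rfl fun i _ ↦ ?_
      refine integral_mul_comp_eq_sum_covariance (C := C) (C' := C) ?_ ?_ (hf' i) (hf'' i)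
        (hC' i) (hC'' i)
      · exact hXY.map_fun ((-Real.sin θ • .proj i ∘L .fst ℝ (ι → ℝ) (ι → ℝ)
            + Real.cos θ • .proj i ∘L .snd ℝ (ι → ℝ) (ι → ℝ) : _ →L[ℝ] ℝ).prod
          (.pi fun j ↦ Real.cos θ • .proj j ∘L .fst ℝ (ι → ℝ) (ι → ℝ)
            + Real.sin θ • .proj j ∘L .snd ℝ (ι → ℝ) (ι → ℝ)))
      · rw [hW, integral_add ((hXg i).integrable.const_mul _) ((hYg i).integrable.const_mul _),
          integral_const_mul, integral_const_mul, hX, hY]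
        simp
    · exact fun i _ ↦ (((hXg i).integrable.const_mul _).add
        ((hYg i).integrable.const_mul _)).mul_bdd (c := C)
        ((hfc' i).measurable.comp_aemeasurable (hZm θ)).aestronglyMeasurable
        (ae_of_all _ fun ω ↦ hC' i _)
  have hcovWZ (θ : ℝ) (i j : ι) : cov[W θ i, Z θ j; P]
      = Real.sin θ * Real.cos θ * (cov[Y i, Y j; P] - cov[X i, X j; P]) := by
    have h1 (c : ℝ) (j : ι) : MemLp (fun ω ↦ c * X j ω) 2 P := (hXg j).memLp_two.const_mul c
    have h2 (c : ℝ) (j : ι) : MemLp (fun ω ↦ c * Y j ω) 2 P := (hYg j).memLp_two.const_mul c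
    change cov[(fun ω ↦ -Real.sin θ * X i ω) + (fun ω ↦ Real.cos θ * Y i ω),
      (fun ω ↦ Real.cos θ * X j ω) + (fun ω ↦ Real.sin θ * Y j ω); P] = _
    rw [covariance_add_left (h1 _ _) (h2 _ _) ((h1 _ _).add (h2 _ _)),
      covariance_add_right (h1 _ _) (h1 _ _) (h2 _ _),
      covariance_add_right (h2 _ _) (h1 _ _) (h2 _ _)]
    simp only [covariance_const_mul_left, covariance_const_mul_right, hcross,
      covariance_comm (Y i) (X j)]
    ring
  have hmono : MonotoneOn (fun θ ↦ ∫ ω, f (fun j ↦ Z θ j ω) ∂P) (Icc 0 (Real.pi / 2)) := by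
    refine monotoneOn_of_deriv_nonneg (convex_Icc _ _)
      (fun θ _ ↦ (hderiv θ).continuousAt.continuousWithinAt)
      (fun θ _ ↦ (hderiv θ).differentiableAt.differentiableWithinAt) fun θ hθ ↦ ?_
    rw [interior_Icc] at hθ
    have hsin : 0 ≤ Real.sin θ :=
      Real.sin_nonneg_of_nonneg_of_le_pi hθ.1.le (by linarith [hθ.2, Real.pi_pos])
    have hcos : 0 ≤ Real.cos θ := Real.cos_nonneg_of_mem_Icc ⟨by linarith [hθ.1, Real.pi_pos],
      hθ.2.le⟩
    rw [(hderiv θ).deriv, hibp θ]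
    refine Finset.sum_nonneg fun i _ ↦ Finset.sum_nonneg fun j _ ↦ ?_
    rw [hcovWZ]
    by_cases hij : i = j
    · subst hij
      simp [hvar]
    · exact mul_nonneg (mul_nonneg (mul_nonneg hsin hcos) (sub_nonneg.2 (hcov i j)))
        (integral_nonneg fun ω ↦ hnonneg i j hij _)
  have h := hmono (left_mem_Icc.2 (by positivity)) (right_mem_Icc.2 (by positivity))
    (by positivity : (0 : ℝ) ≤ Real.pi / 2)
  simpa [hZ] using h

/-- A smooth approximation of the indicator function of `{x | ∀ j, x j < r}` as `k → ∞`. -/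
noncomputable def softOrthant {ι : Type*} [Fintype ι] (k r : ℝ) (x : ι → ℝ) : ℝ :=
  Real.exp (-∑ j, k * Real.exp (k * (x j - r)))

section SoftOrthant

variable {ι : Type*} [Fintype ι]

theorem continuous_softOrthant (k r : ℝ) : Continuous (softOrthant (ι := ι) k r) := by
  unfold softOrthant
  fun_prop

theorem softOrthant_nonneg (k r : ℝ) (x : ι → ℝ) : 0 ≤ softOrthant k r x := (Real.exp_pos _).le

theorem sum_mul_exp_nonneg {k : ℝ} (hk : 0 ≤ k) (r : ℝ) (x : ι → ℝ) :
    0 ≤ ∑ j, k * Real.exp (k * (x j - r)) := Finset.sum_nonneg fun j _ ↦ by positivity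

theorem mul_exp_le_sum {k : ℝ} (hk : 0 ≤ k) (r : ℝ) (x : ι → ℝ) (i : ι) :
    k * Real.exp (k * (x i - r)) ≤ ∑ j, k * Real.exp (k * (x j - r)) :=
  Finset.single_le_sum (f := fun j ↦ k * Real.exp (k * (x j - r))) (fun j _ ↦ by positivity)
    (Finset.mem_univ i)

theorem softOrthant_le_one {k : ℝ} (hk : 0 ≤ k) (r : ℝ) (x : ι → ℝ) : softOrthant k r x ≤ 1 :=
  Real.exp_le_one_iff.2 (neg_nonpos.2 (sum_mul_exp_nonneg hk r x))

theorem abs_softOrthant_le_one {k : ℝ} (hk : 0 ≤ k) (r : ℝ) (x : ι → ℝ) :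
    |softOrthant k r x| ≤ 1 := by
  rw [abs_of_nonneg (softOrthant_nonneg k r x)]
  exact softOrthant_le_one hk r x

theorem mul_exp_mul_softOrthant_le_one {k : ℝ} (hk : 0 ≤ k) (r : ℝ) (x : ι → ℝ) (i : ι) :
    k * Real.exp (k * (x i - r)) * softOrthant k r x ≤ 1 := by
  have h := (mul_exp_le_sum hk r x i).trans
    ((le_add_of_nonneg_right zero_le_one).trans (Real.add_one_le_exp _))
  rw [softOrthant, Real.exp_neg, ← div_eq_mul_inv]
  exact div_le_one_of_le₀ h (Real.exp_pos _).le

theorem mul_exp_mul_mul_exp_mul_softOrthant_le_two {k : ℝ} (hk : 0 ≤ k) (r : ℝ) (x : ι → ℝ)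
    (i j : ι) :
    k * Real.exp (k * (x i - r)) * (k * Real.exp (k * (x j - r))) * softOrthant k r x ≤ 2 := by
  have hS := sum_mul_exp_nonneg hk r x
  have h1 := mul_le_mul (mul_exp_le_sum hk r x i) (mul_exp_le_sum hk r x j) (by positivity) hS
  have h2 := Real.quadratic_le_exp_of_nonneg hS
  rw [softOrthant, Real.exp_neg, ← div_eq_mul_inv, div_le_iff₀ (Real.exp_pos _)]
  nlinarith

theorem hasFDerivAt_mul_exp (k r : ℝ) (x : ι → ℝ) (i : ι) :
    HasFDerivAt (fun x : ι → ℝ ↦ k * Real.exp (k * (x i - r)))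
      ((k * (k * Real.exp (k * (x i - r)))) •
        ContinuousLinearMap.proj (R := ℝ) (φ := fun _ : ι ↦ ℝ) i) x := by
  have h1 : HasFDerivAt (fun x : ι → ℝ ↦ x i)
    (ContinuousLinearMap.proj (R := ℝ) (φ := fun _ : ι ↦ ℝ) i) x := hasFDerivAt_apply i x
  refine ((((h1.sub_const r).const_mul k).exp).const_mul k).congr_fderiv ?_
  ext
  simp
  ring

theorem hasFDerivAt_softOrthant (k r : ℝ) (x : ι → ℝ) :
    HasFDerivAt (softOrthant k r)
      (∑ i, (-(k * (k * Real.exp (k * (x i - r)) * softOrthant k r x))) •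
        ContinuousLinearMap.proj (R := ℝ) (φ := fun _ : ι ↦ ℝ) i) x := by
  refine ((HasFDerivAt.fun_sum fun i _ ↦ hasFDerivAt_mul_exp k r x i).neg.exp).congr_fderiv ?_
  rw [← Finset.sum_neg_distrib, Finset.smul_sum]
  refine Finset.sum_congr rfl fun i _ ↦ ?_
  rw [← neg_smul, smul_smul, softOrthant]
  congr 1
  simp only [Pi.neg_apply]
  ring

theorem hasFDerivAt_deriv_softOrthant [DecidableEq ι] (k r : ℝ) (i : ι) (x : ι → ℝ) :
    HasFDerivAt (fun x : ι → ℝ ↦ -(k * (k * Real.exp (k * (x i - r)) * softOrthant k r x)))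
      (∑ j, (k ^ 2 * (k * Real.exp (k * (x i - r)) * (k * Real.exp (k * (x j - r)))
          * softOrthant k r x)
          - if j = i then k ^ 2 * (k * Real.exp (k * (x i - r)) * softOrthant k r x) else 0) •
        ContinuousLinearMap.proj (R := ℝ) (φ := fun _ : ι ↦ ℝ) j) x := by
  refine ((((hasFDerivAt_mul_exp k r x i).mul (hasFDerivAt_softOrthant k r x)).const_mul
    k).neg).congr_fderiv ?_
  ext v
  simp only [neg_apply, smul_apply, add_apply, sum_apply, ContinuousLinearMap.proj_apply,
    smul_eq_mul, sub_mul, ite_mul, zero_mul, Finset.sum_sub_distrib, Finset.sum_ite_eq',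
    Finset.mem_univ, if_true, Finset.mul_sum, mul_add, neg_add]
  rw [sub_eq_add_neg, ← Finset.sum_neg_distrib]
  congr 1
  · exact Finset.sum_congr rfl fun j _ ↦ by ring
  · ring

theorem tendsto_softOrthant (r : ℝ) (x : ι → ℝ) :
    Tendsto (fun k : ℕ ↦ softOrthant k r x) atTop
      (𝓝 ({x : ι → ℝ | ∀ j, x j < r}.indicator 1 x)) := by
  unfold softOrthant
  by_cases h : ∀ j, x j < r
  · rw [indicator_of_mem (by exact h), Pi.one_apply, ← Real.exp_zero, ← neg_zero]
    refine (Real.continuous_exp.tendsto _).comp (Tendsto.neg ?_)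
    rw [← Finset.sum_const_zero (ι := ι) (s := Finset.univ)]
    refine tendsto_finsetSum _ fun j _ ↦ ?_
    have h1 := (tendsto_rpow_mul_exp_neg_mul_atTop_nhds_zero 1 (r - x j)
      (sub_pos.2 (h j))).comp tendsto_natCast_atTop_atTop
    refine h1.congr fun k ↦ ?_
    simp only [Function.comp_apply, Real.rpow_one]
    congr 2
    ring
  · rw [indicator_of_notMem (by exact h)]
    push Not at h
    obtain ⟨j, hj⟩ := h
    refine Real.tendsto_exp_neg_atTop_nhds_zero.comp
      (tendsto_atTop_mono (fun k : ℕ ↦ ?_) tendsto_natCast_atTop_atTop)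
    have hk : (0 : ℝ) ≤ k := k.cast_nonneg
    refine le_trans ?_ (mul_exp_le_sum hk r x j)
    exact le_mul_of_one_le_right hk (Real.one_le_exp (mul_nonneg hk (sub_nonneg.2 hj)))

end SoftOrthant

/-- A family of random variables all of whose linear combinations are Gaussian is a Gaussian
vector. -/
theorem hasGaussianLaw_of_forall_sum_mul {Ω ι : Type*} [Fintype ι] [MeasurableSpace Ω]
    {P : Measure Ω} {X : ι → Ω → ℝ} (hXm : ∀ j, Measurable (X j))
    (h : ∀ c : ι → ℝ, ∃ v : NNReal, P.map (fun ω ↦ ∑ j, c j * X j ω) = gaussianReal 0 v) :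
    HasGaussianLaw (fun ω j ↦ X j ω) P where
  isGaussian_map := by
    classical
    refine isGaussian_of_map_eq_gaussianReal fun L ↦ ?_
    obtain ⟨v, hv⟩ := h fun j ↦ L fun i ↦ if j = i then 1 else 0
    refine ⟨0, v, ?_⟩
    rw [Measure.map_map L.continuous.measurable (measurable_pi_lambda _ hXm), ← hv]
    congr 1 with ω
    rw [Function.comp_apply, ← L.coe_coe, L.toLinearMap.pi_apply_eq_sum_univ]
    simp [mul_comm]

theorem integral_eq_zero_of_forall_sum_mul {Ω ι : Type*} [Fintype ι] [MeasurableSpace Ω]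
    {P : Measure Ω} {X : ι → Ω → ℝ} (hXm : ∀ j, Measurable (X j))
    (h : ∀ c : ι → ℝ, ∃ v : NNReal, P.map (fun ω ↦ ∑ j, c j * X j ω) = gaussianReal 0 v)
    (j : ι) : P[X j] = 0 := by
  classical
  obtain ⟨v, hv⟩ := h (Pi.single j 1)
  simp only [Pi.single_apply, ite_mul, one_mul, zero_mul, Finset.sum_ite_eq', Finset.mem_univ,
    if_true] at hv
  have h1 := integral_map (μ := P) (hXm j).aemeasurable (f := fun x : ℝ ↦ x) (by fun_prop)
  rw [← h1, hv, integral_id_gaussianReal]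

theorem covariance_eq_integral_mul {Ω : Type*} [MeasurableSpace Ω] {P : Measure Ω} {X Y : Ω → ℝ}
    (hX : P[X] = 0) (hY : P[Y] = 0) : cov[X, Y; P] = ∫ ω, X ω * Y ω ∂P := by
  simp [covariance, hX, hY]

theorem measurableSet_forall_lt {Ω ι : Type*} [Countable ι] [MeasurableSpace Ω] {X : ι → Ω → ℝ}
    (hXm : ∀ j, Measurable (X j)) (r : ℝ) : MeasurableSet {ω | ∀ j, X j ω < r} := by
  rw [ofPred_forall]
  exact MeasurableSet.iInter fun j ↦ measurableSet_lt (hXm j) measurable_const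

theorem tendsto_integral_softOrthant {Ω ι : Type*} [Fintype ι] [MeasurableSpace Ω]
    {P : Measure Ω} [IsProbabilityMeasure P] {X : ι → Ω → ℝ} (hXm : ∀ j, Measurable (X j))
    (r : ℝ) :
    Tendsto (fun k : ℕ ↦ ∫ ω, softOrthant k r (fun j ↦ X j ω) ∂P) atTop
      (𝓝 (P.real {ω | ∀ j, X j ω < r})) := by
  rw [← integral_indicator_one (measurableSet_forall_lt hXm r)]
  refine tendsto_integral_of_dominated_convergence (fun _ ↦ 1)
    (fun k ↦ ((continuous_softOrthant k r).measurable.comp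
      (measurable_pi_lambda _ hXm)).aestronglyMeasurable) (integrable_const _)
    (fun k ↦ ae_of_all _ fun ω ↦ abs_softOrthant_le_one k.cast_nonneg r _)
    (ae_of_all _ fun ω ↦ tendsto_softOrthant r fun j ↦ X j ω)

/-- Comparison of orthant probabilities of two Gaussian vectors on the same probability space. -/
theorem measureReal_forall_lt_le_of_covariance_le {Ω ι : Type*} [Fintype ι]
    [MeasurableSpace Ω] {P : Measure Ω} {X Y : ι → Ω → ℝ}
    (hXm : ∀ j, Measurable (X j)) (hYm : ∀ j, Measurable (Y j))
    (hXY : HasGaussianLaw (fun ω ↦ ((fun j ↦ X j ω, fun j ↦ Y j ω) : (ι → ℝ) × (ι → ℝ))) P)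
    (hX : ∀ j, P[X j] = 0) (hY : ∀ j, P[Y j] = 0) (hcross : ∀ i j, cov[X i, Y j; P] = 0)
    (hvar : ∀ j, cov[X j, X j; P] = cov[Y j, Y j; P])
    (hcov : ∀ i j, cov[X i, X j; P] ≤ cov[Y i, Y j; P]) (r : ℝ) :
    P.real {ω | ∀ j, X j ω < r} ≤ P.real {ω | ∀ j, Y j ω < r} := by
  classical
  have : IsProbabilityMeasure P := hXY.isProbabilityMeasure
  refine le_of_tendsto_of_tendsto' (tendsto_integral_softOrthant hXm r)
    (tendsto_integral_softOrthant hYm r) fun k ↦ ?_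
  have hk : (0 : ℝ) ≤ k := k.cast_nonneg
  have hs (x : ι → ℝ) := softOrthant_nonneg (k : ℝ) r x
  refine integral_comp_le_integral_comp_of_covariance_le (C := 1 + k + 3 * (k : ℝ) ^ 2)
    hXY hX hY hcross hvar hcov (hasFDerivAt_softOrthant (k : ℝ) r)
    (hasFDerivAt_deriv_softOrthant (k : ℝ) r) ?_ ?_ ?_ ?_ ?_
  · intro i j
    have := continuous_softOrthant (ι := ι) k r
    split_ifs <;> fun_prop
  · exact fun x ↦ (abs_softOrthant_le_one hk r x).trans (by nlinarith)
  · intro i x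
    have h0 : 0 ≤ k * Real.exp (k * (x i - r)) * softOrthant k r x :=
      mul_nonneg (by positivity) (hs x)
    have h1 := mul_exp_mul_softOrthant_le_one hk r x i
    rw [abs_neg, abs_of_nonneg (mul_nonneg hk h0)]
    nlinarith
  · intro i j x
    have h0 : 0 ≤ k * Real.exp (k * (x i - r)) * softOrthant k r x :=
      mul_nonneg (by positivity) (hs x)
    have h1 := mul_exp_mul_softOrthant_le_one hk r x i
    have h2 : 0 ≤ k * Real.exp (k * (x i - r)) * (k * Real.exp (k * (x j - r)))
        * softOrthant k r x := mul_nonneg (by positivity) (hs x)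
    have h3 := mul_exp_mul_mul_exp_mul_softOrthant_le_two hk r x i j
    have hk2 := sq_nonneg (k : ℝ)
    have h4 := mul_le_mul_of_nonneg_left h1 hk2
    have h5 := mul_le_mul_of_nonneg_left h3 hk2
    have h6 := mul_nonneg hk2 h0
    have h7 := mul_nonneg hk2 h2
    rw [abs_le]
    split_ifs <;> constructor <;> linarith
  · intro i j hij x
    rw [if_neg hij.symm, sub_zero]
    exact mul_nonneg (by positivity) (mul_nonneg (by positivity) (hs x))

theorem setOf_le_iSup_eq_compl {Ω ι : Type*} [Finite ι] [Nonempty ι] (X : ι → Ω → ℝ) (r : ℝ) :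
    {ω | r ≤ ⨆ j, X j ω} = {ω | ∀ j, X j ω < r}ᶜ := by
  ext ω
  simp only [mem_ofPred_eq, mem_compl_iff, not_forall, not_lt]
  refine ⟨fun h ↦ ?_, fun ⟨j, hj⟩ ↦ hj.trans (le_ciSup (finite_range fun j ↦ X j ω).bddAbove j)⟩
  obtain ⟨j, hj⟩ := exists_eq_ciSup_of_finite (f := fun j ↦ X j ω)
  exact ⟨j, h.trans_eq hj.symm⟩

/-- Slepian's inequality: if `U` and `V` are centered Gaussian vectors with equal variances
and the covariances of `U` dominated by those of `V`, then
`P(max_j U_j ≥ r) ≥ P(max_j V_j ≥ r)` for every real `r`. -/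
theorem slepian_inequality {Ω₁ Ω₂ : Type*} [MeasurableSpace Ω₁] [MeasurableSpace Ω₂]
    (μ : Measure Ω₁) (ν : Measure Ω₂)
    [IsProbabilityMeasure μ] [IsProbabilityMeasure ν]
    (n : ℕ) (hn : 1 ≤ n) (U : Fin n → Ω₁ → ℝ) (V : Fin n → Ω₂ → ℝ)
    (hUm : ∀ j, Measurable (U j)) (hVm : ∀ j, Measurable (V j))
    (hUgauss : ∀ c : Fin n → ℝ, ∃ v : NNReal,
      Measure.map (fun ω => ∑ j, c j * U j ω) μ = gaussianReal 0 v)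
    (hVgauss : ∀ c : Fin n → ℝ, ∃ v : NNReal,
      Measure.map (fun ω => ∑ j, c j * V j ω) ν = gaussianReal 0 v)
    (hvar : ∀ j, ∫ ω, (U j ω) ^ 2 ∂μ = ∫ ω, (V j ω) ^ 2 ∂ν)
    (hcov : ∀ i j, ∫ ω, U i ω * U j ω ∂μ ≤ ∫ ω, V i ω * V j ω ∂ν)
    (r : ℝ) :
    ν {ω | r ≤ ⨆ j, V j ω} ≤ μ {ω | r ≤ ⨆ j, U j ω} := by
  have hUg := hasGaussianLaw_of_forall_sum_mul hUm hUgauss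
  have hVg := hasGaussianLaw_of_forall_sum_mul hVm hVgauss
  have hU0 := integral_eq_zero_of_forall_sum_mul hUm hUgauss
  have hV0 := integral_eq_zero_of_forall_sum_mul hVm hVgauss
  have hfst {f : Ω₁ → ℝ} : ∫ p : Ω₁ × Ω₂, f p.1 ∂μ.prod ν = ∫ ω, f ω ∂μ := by
    simpa using integral_fun_fst (μ := μ) (ν := ν) f
  have hsnd {f : Ω₂ → ℝ} : ∫ p : Ω₁ × Ω₂, f p.2 ∂μ.prod ν = ∫ ω, f ω ∂ν := by
    simpa using integral_fun_snd (μ := μ) (ν := ν) f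
  have hX0 (j : Fin n) : ∫ p : Ω₁ × Ω₂, U j p.1 ∂μ.prod ν = 0 := hfst.trans (hU0 j)
  have hY0 (j : Fin n) : ∫ p : Ω₁ × Ω₂, V j p.2 ∂μ.prod ν = 0 := hsnd.trans (hV0 j)
  have hXY : HasGaussianLaw (fun p : Ω₁ × Ω₂ ↦
      ((fun j ↦ U j p.1, fun j ↦ V j p.2) : (Fin n → ℝ) × (Fin n → ℝ))) (μ.prod ν) := by
    have := hUg.isGaussian_map
    have := hVg.isGaussian_map
    refine ⟨?_⟩
    change IsGaussian ((μ.prod ν).map (Prod.map (fun ω j ↦ U j ω) fun ω j ↦ V j ω))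
    rw [← Measure.map_prod_map μ ν (measurable_pi_lambda _ hUm) (measurable_pi_lambda _ hVm)]
    infer_instance
  have hcovX (i j : Fin n) : cov[fun p : Ω₁ × Ω₂ ↦ U i p.1, fun p ↦ U j p.1; μ.prod ν]
      = ∫ ω, U i ω * U j ω ∂μ :=
    (covariance_eq_integral_mul (hX0 i) (hX0 j)).trans (hfst (f := fun ω ↦ U i ω * U j ω))
  have hcovY (i j : Fin n) : cov[fun p : Ω₁ × Ω₂ ↦ V i p.2, fun p ↦ V j p.2; μ.prod ν]
      = ∫ ω, V i ω * V j ω ∂ν :=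
    (covariance_eq_integral_mul (hY0 i) (hY0 j)).trans (hsnd (f := fun ω ↦ V i ω * V j ω))
  have key := measureReal_forall_lt_le_of_covariance_le (P := μ.prod ν)
    (X := fun j p ↦ U j p.1) (Y := fun j p ↦ V j p.2)
    (fun j ↦ (hUm j).comp measurable_fst) (fun j ↦ (hVm j).comp measurable_snd) hXY hX0 hY0
    (fun i j ↦ by
      rw [covariance_eq_integral_mul (hX0 i) (hY0 j), integral_prod_mul, hU0, zero_mul])
    (fun j ↦ by simpa only [hcovX, hcovY, pow_two] using hvar j)
    (fun i j ↦ by simpa only [hcovX, hcovY] using hcov i j) r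
  have hUr : (μ.prod ν).real {p : Ω₁ × Ω₂ | ∀ j, U j p.1 < r} = μ.real {ω | ∀ j, U j ω < r} := by
    have h := measureReal_prod_prod (μ := μ) (ν := ν) {ω | ∀ j, U j ω < r} univ
    simpa [Set.prod_univ] using h
  have hVr : (μ.prod ν).real {p : Ω₁ × Ω₂ | ∀ j, V j p.2 < r} = ν.real {ω | ∀ j, V j ω < r} := by
    have h := measureReal_prod_prod (μ := μ) (ν := ν) univ {ω | ∀ j, V j ω < r}
    simpa [Set.univ_prod] using h
  rw [hUr, hVr] at key
  have : Nonempty (Fin n) := ⟨⟨0, hn⟩⟩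
  rw [setOf_le_iSup_eq_compl, setOf_le_iSup_eq_compl, ← ofReal_measureReal, ← ofReal_measureReal,
    probReal_compl_eq_one_sub (measurableSet_forall_lt hVm r),
    probReal_compl_eq_one_sub (measurableSet_forall_lt hUm r)]
  exact ENNReal.ofReal_le_ofReal (sub_le_sub_left key 1)
end

section
/- (Generalized Slepian inequality.) Let n ≥ 1 and let U = (U₁, …, Uₙ) and V = (V₁, …, Vₙ) be centered Gaussian random vectors such that E[Uⱼ²] = E[Vⱼ²] for all 1 ≤ j ≤ n and E[UᵢUⱼ] ≤ E[VᵢVⱼ] for all 1 ≤ i, j ≤ n. Then for all positive real numbers r₁, …, rₙ, P(∃ j ≤ n : Uⱼ ≥ rⱼ) ≥ P(∃ j ≤ n : Vⱼ ≥ rⱼ). -/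
open Filter Set Topology MeasureTheory ProbabilityTheory

/-- A bounded continuous nonnegative function on `ι → ℝ` with a uniform second order Taylor
expansion, whose first order coefficients are nonpositive and whose off-diagonal second order
coefficients are nonnegative. -/
structure HasSlepianExpansion {ι : Type*} [Fintype ι] (f : (ι → ℝ) → ℝ)
    (a : (ι → ℝ) → ι → ℝ) (b : (ι → ℝ) → ι → ι → ℝ) (C : ℝ) : Prop where
  continuous : Continuous f
  nonneg : ∀ x, 0 ≤ f x
  le_bound : ∀ x, f x ≤ C
  gradient_nonpos : ∀ x i, a x i ≤ 0
  hessian_nonneg : ∀ x i j, i ≠ j → 0 ≤ b x i j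
  abs_gradient_le : ∀ x h : ι → ℝ, |∑ i, a x i * h i| ≤ C * ‖h‖
  abs_hessian_le : ∀ x h : ι → ℝ, |1 / 2 * ∑ i, ∑ j, b x i j * (h i * h j)| ≤ C * ‖h‖ ^ 2
  abs_remainder_le : ∀ x h : ι → ℝ,
    |f (x + h) - (f x + ∑ i, a x i * h i + 1 / 2 * ∑ i, ∑ j, b x i j * (h i * h j))|
      ≤ C * ‖h‖ ^ 3

/-- Remainder estimate for the product of two truncated second order expansions. -/
lemma abs_mul_sub_expansion_le {C t p q F G α β α' β' : ℝ} (ht : 0 ≤ t)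
    (hp : |p| ≤ C) (hq : |q| ≤ C) (hF : |F| ≤ C) (hG : |G| ≤ C)
    (hα : |α| ≤ C * t) (hα' : |α'| ≤ C * t) (hβ : |β| ≤ C * t ^ 2) (hβ' : |β'| ≤ C * t ^ 2)
    (hR : |F - (p + α + β)| ≤ C * t ^ 3) (hS : |G - (q + α' + β')| ≤ C * t ^ 3) :
    |F * G - (p * q + (p * α' + q * α) + (p * β' + q * β + α * α'))| ≤ 7 * C ^ 2 * t ^ 3 := by
  have hC : 0 ≤ C := (abs_nonneg p).trans hp
  have mul_bound : ∀ {x y X Y : ℝ}, |x| ≤ X → |y| ≤ Y → |x * y| ≤ X * Y := fun hx hy ↦ by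
    rw [abs_mul]
    exact mul_le_mul hx hy (abs_nonneg _) ((abs_nonneg _).trans hx)
  have hC2 : 0 ≤ C ^ 2 := sq_nonneg C
  rcases le_total t 1 with h1 | h1
  · have e : F * G - (p * q + (p * α' + q * α) + (p * β' + q * β + α * α'))
        = F * (G - (q + α' + β')) + (F - (p + α + β)) * q + (F - (p + α + β)) * α'
          + (F - (p + α + β)) * β' + α * β' + β * α' + β * β' := by ring
    have t2 : t ^ 2 ≤ 1 := by nlinarith
    have b1 := mul_bound hF hS
    have b2 := mul_bound hR hq
    have b3 := mul_bound hR hα'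
    have b4 := mul_bound hR hβ'
    have b5 := mul_bound hα hβ'
    have b6 := mul_bound hβ hα'
    have b7 := mul_bound hβ hβ'
    have k : 0 ≤ C ^ 2 * t ^ 3 := by positivity
    have k1 : C ^ 2 * t ^ 3 * t ≤ C ^ 2 * t ^ 3 := mul_le_of_le_one_right k h1
    have k2 : C ^ 2 * t ^ 3 * t ^ 2 ≤ C ^ 2 * t ^ 3 := mul_le_of_le_one_right k t2
    rw [e, abs_le]
    rw [abs_le] at b1 b2 b3 b4 b5 b6 b7
    constructor <;> nlinarith
  · have t2 : t ≤ t ^ 3 := le_self_pow₀ h1 (by norm_num)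
    have t3 : t ^ 2 ≤ t ^ 3 := pow_le_pow_right₀ h1 (by norm_num)
    have t4 : 1 ≤ t ^ 3 := one_le_pow₀ h1
    have b1 := mul_bound hF hG
    have b2 := mul_bound hp hq
    have b3 := mul_bound hp hα'
    have b4 := mul_bound hq hα
    have b5 := mul_bound hp hβ'
    have b6 := mul_bound hq hβ
    have b7 := mul_bound hα hα'
    have k1 := mul_le_mul_of_nonneg_left t2 hC2
    have k2 := mul_le_mul_of_nonneg_left t3 hC2
    have k3 := mul_le_mul_of_nonneg_left t4 hC2
    rw [abs_le] at b1 b2 b3 b4 b5 b6 b7 ⊢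
    constructor <;> nlinarith

namespace HasSlepianExpansion

variable {ι : Type*} [Fintype ι] {f g : (ι → ℝ) → ℝ} {a a' : (ι → ℝ) → ι → ℝ}
  {b b' : (ι → ℝ) → ι → ι → ℝ} {C C' : ℝ}

lemma bound_nonneg (hf : HasSlepianExpansion f a b C) : 0 ≤ C :=
  (hf.nonneg 0).trans (hf.le_bound 0)

lemma mono (hf : HasSlepianExpansion f a b C) (h : C ≤ C') : HasSlepianExpansion f a b C' where
  continuous := hf.continuous
  nonneg := hf.nonneg
  le_bound x := (hf.le_bound x).trans h
  gradient_nonpos := hf.gradient_nonpos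
  hessian_nonneg := hf.hessian_nonneg
  abs_gradient_le x v := (hf.abs_gradient_le x v).trans (by gcongr)
  abs_hessian_le x v := (hf.abs_hessian_le x v).trans (by gcongr)
  abs_remainder_le x v := (hf.abs_remainder_le x v).trans (by gcongr)

lemma one : HasSlepianExpansion (fun _ : ι → ℝ ↦ 1) 0 0 1 where
  continuous := continuous_const
  nonneg _ := zero_le_one
  le_bound _ := le_rfl
  gradient_nonpos _ _ := le_rfl
  hessian_nonneg _ _ _ _ := le_rfl
  abs_gradient_le x v := by simp
  abs_hessian_le x v := by simp
  abs_remainder_le x v := by simp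

lemma mul (hf : HasSlepianExpansion f a b C) (hg : HasSlepianExpansion g a' b' C) :
    HasSlepianExpansion (fun x ↦ f x * g x) (fun x i ↦ f x * a' x i + g x * a x i)
      (fun x i j ↦ f x * b' x i j + g x * b x i j + (a x i * a' x j + a' x i * a x j))
      (7 * C ^ 2) := by
  have hC := hf.bound_nonneg
  have grad (x h : ι → ℝ) : ∑ i, (f x * a' x i + g x * a x i) * h i
      = f x * ∑ i, a' x i * h i + g x * ∑ i, a x i * h i := by
    simp only [Finset.mul_sum, ← Finset.sum_add_distrib]
    exact Finset.sum_congr rfl fun _ _ ↦ by ring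
  have hess (x h : ι → ℝ) :
      1 / 2 * ∑ i, ∑ j, (f x * b' x i j + g x * b x i j + (a x i * a' x j + a' x i * a x j))
        * (h i * h j)
      = f x * (1 / 2 * ∑ i, ∑ j, b' x i j * (h i * h j))
        + g x * (1 / 2 * ∑ i, ∑ j, b x i j * (h i * h j))
        + (∑ i, a x i * h i) * ∑ i, a' x i * h i := by
    have e1 : (∑ i, a x i * h i) * ∑ i, a' x i * h i
        = ∑ i, ∑ j, (a x i * a' x j) * (h i * h j) := by
      rw [Finset.sum_mul_sum]
      exact Finset.sum_congr rfl fun _ _ ↦ Finset.sum_congr rfl fun _ _ ↦ by ring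
    have e2 : (∑ i, a x i * h i) * ∑ i, a' x i * h i
        = ∑ i, ∑ j, (a' x i * a x j) * (h i * h j) := by
      rw [mul_comm, Finset.sum_mul_sum]
      exact Finset.sum_congr rfl fun _ _ ↦ Finset.sum_congr rfl fun _ _ ↦ by ring
    have e3 : (∑ i, a x i * h i) * ∑ i, a' x i * h i
        = 1 / 2 * ((∑ i, ∑ j, (a x i * a' x j) * (h i * h j))
          + ∑ i, ∑ j, (a' x i * a x j) * (h i * h j)) := by
      rw [← e1, ← e2]; ring
    rw [e3]
    simp only [Finset.mul_sum, ← Finset.sum_add_distrib]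
    exact Finset.sum_congr rfl fun _ _ ↦ Finset.sum_congr rfl fun _ _ ↦ by ring
  have bf (x) : |f x| ≤ C := by rw [abs_of_nonneg (hf.nonneg x)]; exact hf.le_bound x
  have bg (x) : |g x| ≤ C := by rw [abs_of_nonneg (hg.nonneg x)]; exact hg.le_bound x
  have mul_bound : ∀ {x y X Y : ℝ}, |x| ≤ X → |y| ≤ Y → |x * y| ≤ X * Y := fun hx hy ↦ by
    rw [abs_mul]
    exact mul_le_mul hx hy (abs_nonneg _) ((abs_nonneg _).trans hx)
  refine ⟨hf.continuous.mul hg.continuous, fun x ↦ mul_nonneg (hf.nonneg x) (hg.nonneg x),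
    fun x ↦ ?_, fun x i ↦ ?_, fun x i j hij ↦ ?_, fun x h ↦ ?_, fun x h ↦ ?_, fun x h ↦ ?_⟩
  · nlinarith [(abs_le.1 (mul_bound (bf x) (bg x))).2, sq_nonneg C]
  · nlinarith [mul_nonneg (hf.nonneg x) (neg_nonneg.2 (hg.gradient_nonpos x i)),
      mul_nonneg (hg.nonneg x) (neg_nonneg.2 (hf.gradient_nonpos x i))]
  · have h1 := mul_nonneg (hf.nonneg x) (hg.hessian_nonneg x i j hij)
    have h2 := mul_nonneg (hg.nonneg x) (hf.hessian_nonneg x i j hij)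
    have h3 := mul_nonneg_of_nonpos_of_nonpos (hf.gradient_nonpos x i) (hg.gradient_nonpos x j)
    have h4 := mul_nonneg_of_nonpos_of_nonpos (hg.gradient_nonpos x i) (hf.gradient_nonpos x j)
    positivity
  · rw [grad]
    have h1 := mul_bound (bf x) (hg.abs_gradient_le x h)
    have h2 := mul_bound (bg x) (hf.abs_gradient_le x h)
    have k : 0 ≤ C ^ 2 * ‖h‖ := by positivity
    refine (abs_add_le _ _).trans ?_
    nlinarith
  · rw [hess]
    have h1 := mul_bound (bf x) (hg.abs_hessian_le x h)
    have h2 := mul_bound (bg x) (hf.abs_hessian_le x h)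
    have h3 := mul_bound (hf.abs_gradient_le x h) (hg.abs_gradient_le x h)
    have k : 0 ≤ C ^ 2 * ‖h‖ ^ 2 := by positivity
    refine (abs_add_three _ _ _).trans ?_
    nlinarith
  · rw [grad, hess]
    exact abs_mul_sub_expansion_le (norm_nonneg h) (bf x) (bg x) (bf _) (bg _)
      (hf.abs_gradient_le x h) (hg.abs_gradient_le x h) (hf.abs_hessian_le x h)
      (hg.abs_hessian_le x h) (hf.abs_remainder_le x h) (hg.abs_remainder_le x h)

lemma exists_prod {κ : Type*} (s : Finset κ) {F : κ → (ι → ℝ) → ℝ}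
    (hF : ∀ k, ∃ a b C, HasSlepianExpansion (F k) a b C) :
    ∃ a b C, HasSlepianExpansion (fun x ↦ ∏ k ∈ s, F k x) a b C := by
  classical
  induction s using Finset.induction_on with
  | empty => exact ⟨0, 0, 1, by simpa using one⟩
  | insert k s hk ih =>
    obtain ⟨a, b, C, h⟩ := hF k
    obtain ⟨a', b', C', h'⟩ := ih
    simp only [Finset.prod_insert hk]
    exact ⟨_, _, _, (h.mono (le_max_left C C')).mul (h'.mono (le_max_right C C'))⟩

end HasSlepianExpansion

/-- Second order Taylor expansion with a uniform remainder bound, for a `C³` function whose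
derivative has compact support. -/
lemma exists_abs_taylor_two_le {φ : ℝ → ℝ} (hφ : ContDiff ℝ 3 φ)
    (hs : HasCompactSupport (deriv φ)) :
    ∃ C, 0 ≤ C ∧ (∀ x, |deriv φ x| ≤ C) ∧ (∀ x, |deriv (deriv φ) x| ≤ C) ∧
      ∀ x h, |φ (x + h) - (φ x + deriv φ x * h + 1 / 2 * (deriv (deriv φ) x * (h * h)))|
        ≤ C * |h| ^ 3 := by
  have c1 : ContDiff ℝ 2 (deriv φ) := ((contDiff_succ_iff_deriv (n := 2)).1 hφ).2.2
  have c2 : ContDiff ℝ 1 (deriv (deriv φ)) := ((contDiff_succ_iff_deriv (n := 1)).1 c1).2.2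
  have c3 : ContDiff ℝ 0 (deriv (deriv (deriv φ))) := ((contDiff_succ_iff_deriv (n := 0)).1 c2).2.2
  obtain ⟨C1, h1⟩ := hs.exists_bound_of_continuous c1.continuous
  obtain ⟨C2, h2⟩ := hs.deriv.exists_bound_of_continuous c2.continuous
  obtain ⟨C3, h3⟩ := hs.deriv.deriv.exists_bound_of_continuous c3.continuous
  simp only [Real.norm_eq_abs] at h1 h2 h3
  have p1 : 0 ≤ C1 := (abs_nonneg _).trans (h1 0)
  have p2 : 0 ≤ C2 := (abs_nonneg _).trans (h2 0)
  have p3 : 0 ≤ C3 := (abs_nonneg _).trans (h3 0)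
  refine ⟨C1 + C2 + C3, by positivity, fun x ↦ (h1 x).trans (by linarith),
    fun x ↦ (h2 x).trans (by linarith), fun x h ↦ ?_⟩
  rcases eq_or_ne h 0 with rfl | hh
  · simp
  have hne : x ≠ x + h := by simpa using hh
  obtain ⟨y, -, hy⟩ := taylor_mean_remainder_lagrange_iteratedDeriv (n := 2) hne
    (f := φ) (by norm_num; exact hφ.contDiffOn)
  have hu := uniqueDiffOn_uIcc hne
  have i1 : iteratedDerivWithin 1 φ (uIcc x (x + h)) x = deriv φ x := by
    rw [iteratedDerivWithin_eq_iteratedDeriv hu (hφ.of_le (by norm_num)).contDiffAt left_mem_uIcc,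
      iteratedDeriv_one]
  have i2 : iteratedDerivWithin 2 φ (uIcc x (x + h)) x = deriv (deriv φ) x := by
    rw [iteratedDerivWithin_eq_iteratedDeriv hu (hφ.of_le (by norm_num)).contDiffAt left_mem_uIcc,
      iteratedDeriv_succ, iteratedDeriv_one]
  have i3 : iteratedDeriv 3 φ y = deriv (deriv (deriv φ)) y := by
    rw [iteratedDeriv_succ, iteratedDeriv_succ, iteratedDeriv_one]
  rw [taylorWithinEval_succ, taylorWithinEval_succ, taylor_within_zero_eval] at hy
  norm_num [i1, i2, i3, Nat.factorial] at hy
  have e : φ (x + h) - (φ x + deriv φ x * h + 1 / 2 * (deriv (deriv φ) x * (h * h)))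
      = deriv (deriv (deriv φ)) y * h ^ 3 / 6 := by rw [← hy]; ring
  rw [e, abs_div, abs_mul, abs_pow]
  have := mul_le_mul_of_nonneg_right (h3 y) (by positivity : 0 ≤ |h| ^ 3)
  have k : 0 ≤ |h| ^ 3 := by positivity
  have k1 := mul_nonneg p1 k
  have k2 := mul_nonneg p2 k
  have k3 := mul_nonneg p3 k
  norm_num
  nlinarith

/-- Smooth antitone cutoffs depending on one coordinate admit a Slepian expansion. -/
lemma HasSlepianExpansion.exists_comp_apply {ι : Type*} [Fintype ι] {φ : ℝ → ℝ}
    (hφ : ContDiff ℝ 3 φ) (hs : HasCompactSupport (deriv φ)) (hanti : Antitone φ)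
    (h0 : ∀ x, 0 ≤ φ x) (h1 : ∀ x, φ x ≤ 1) (k : ι) :
    ∃ a b C, HasSlepianExpansion (fun x : ι → ℝ ↦ φ (x k)) a b C := by
  classical
  obtain ⟨C, hC, hd1, hd2, ht⟩ := exists_abs_taylor_two_le hφ hs
  have grad (x h : ι → ℝ) : ∑ i, (if i = k then deriv φ (x k) else 0) * h i
      = deriv φ (x k) * h k := by simp
  have hess (x h : ι → ℝ) :
      ∑ i, ∑ j, (if i = k ∧ j = k then deriv (deriv φ) (x k) else 0) * (h i * h j)
      = deriv (deriv φ) (x k) * (h k * h k) := by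
    rw [Finset.sum_eq_single k, Finset.sum_eq_single k] <;> simp +contextual
  refine ⟨fun x i ↦ if i = k then deriv φ (x k) else 0,
    fun x i j ↦ if i = k ∧ j = k then deriv (deriv φ) (x k) else 0, 1 + C,
    hφ.continuous.comp (continuous_apply k), fun x ↦ h0 _, fun x ↦ (h1 _).trans (by linarith),
    fun x i ↦ ?_, fun x i j hij ↦ ?_, fun x h ↦ ?_, fun x h ↦ ?_, fun x h ↦ ?_⟩
  · split_ifs
    · exact hanti.deriv_nonpos
    · exact le_rfl
  · rw [if_neg]
    rintro ⟨rfl, rfl⟩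
    exact hij rfl
  · rw [grad, abs_mul]
    gcongr
    · linarith [hd1 (x k)]
    · exact norm_le_pi_norm h k
  · rw [hess, abs_mul, abs_mul, ← sq, abs_pow]
    have : |h k| ^ 2 ≤ ‖h‖ ^ 2 := by gcongr; exact norm_le_pi_norm h k
    have k3 := mul_le_mul (hd2 (x k)) this (by positivity) hC
    have : 0 ≤ C * ‖h‖ ^ 2 := by positivity
    rw [abs_of_pos (by norm_num : (0 : ℝ) < 1 / 2)]
    nlinarith [sq_nonneg ‖h‖]
  · rw [grad, hess, Pi.add_apply]
    refine (ht _ _).trans ?_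
    gcongr
    · linarith
    · exact norm_le_pi_norm h k

/-- Second order expansion of the expectation of a function under a small centered
perturbation. -/
lemma HasSlepianExpansion.abs_integral_sub_le {ι : Type*} [Fintype ι] {f : (ι → ℝ) → ℝ}
    {a : (ι → ℝ) → ι → ℝ} {b : (ι → ℝ) → ι → ι → ℝ} {C : ℝ}
    (hf : HasSlepianExpansion f a b C) (μ : Measure (ι → ℝ)) [IsProbabilityMeasure μ]
    (hμ : MemLp id 3 μ) (h0 : ∀ i, ∫ y, y i ∂μ = 0) (x : ι → ℝ) {c : ℝ} (hc : 0 ≤ c) :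
    |∫ y, f (x + c • y) ∂μ - (f x + c ^ 2 / 2 * ∑ i, ∑ j, b x i j * ∫ y, y i * y j ∂μ)|
      ≤ C * c ^ 3 * ∫ y, ‖y‖ ^ 3 ∂μ := by
  have coord (i : ι) : MemLp (fun y : ι → ℝ ↦ y i) 3 μ :=
    hμ.mono (measurable_pi_apply i).aestronglyMeasurable
      (ae_of_all _ fun y ↦ norm_le_pi_norm y i)
  have int1 (i : ι) : Integrable (fun y : ι → ℝ ↦ y i) μ :=
    (coord i).integrable (by norm_num)
  have int2 (i j : ι) : Integrable (fun y : ι → ℝ ↦ y i * y j) μ :=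
    ((coord i).mono_exponent (by norm_num : (2 : ENNReal) ≤ 3)).integrable_mul
      ((coord j).mono_exponent (by norm_num : (2 : ENNReal) ≤ 3))
  have int3 : Integrable (fun y : ι → ℝ ↦ ‖y‖ ^ 3) μ := by
    simpa using hμ.integrable_norm_pow (p := 3) (by norm_num)
  have intf : Integrable (fun y ↦ f (x + c • y)) μ := by
    refine Integrable.of_bound (C := C) ?_ (ae_of_all _ fun y ↦ ?_)
    · exact (hf.continuous.comp (by fun_prop)).aestronglyMeasurable
    · rw [Real.norm_of_nonneg (hf.nonneg _)]
      exact hf.le_bound _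
  have ints1 : Integrable (fun y : ι → ℝ ↦ ∑ i, a x i * (c • y) i) μ :=
    integrable_finsetSum _ fun i _ ↦ ((int1 i).const_mul c).const_mul _
  have e2 (y : ι → ℝ) (i j : ι) : b x i j * ((c • y) i * (c • y) j)
      = (b x i j * c ^ 2) * (y i * y j) := by
    simp only [Pi.smul_apply, smul_eq_mul]; ring
  have ints2 : Integrable
      (fun y : ι → ℝ ↦ 1 / 2 * ∑ i, ∑ j, b x i j * ((c • y) i * (c • y) j)) μ := by
    simp only [e2]
    exact (integrable_finsetSum _ fun i _ ↦ integrable_finsetSum _ fun j _ ↦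
      (int2 i j).const_mul _).const_mul _
  have ints01 : Integrable (fun y : ι → ℝ ↦ f x + ∑ i, a x i * (c • y) i) μ :=
    (integrable_const (f x)).add ints1
  have intp : Integrable (fun y : ι → ℝ ↦ f x + ∑ i, a x i * (c • y) i
      + 1 / 2 * ∑ i, ∑ j, b x i j * ((c • y) i * (c • y) j)) μ := ints01.add ints2
  have key : ∫ y, (f x + ∑ i, a x i * (c • y) i
        + 1 / 2 * ∑ i, ∑ j, b x i j * ((c • y) i * (c • y) j)) ∂μ
      = f x + c ^ 2 / 2 * ∑ i, ∑ j, b x i j * ∫ y, y i * y j ∂μ := by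
    have v1 : ∫ y, ∑ i, a x i * (c • y) i ∂μ = 0 := by
      simp only [Pi.smul_apply, smul_eq_mul]
      rw [integral_finsetSum _ fun i _ ↦ ((int1 i).const_mul c).const_mul _]
      simp only [integral_const_mul, h0]
      simp
    have v2 : ∫ y, 1 / 2 * ∑ i, ∑ j, b x i j * ((c • y) i * (c • y) j) ∂μ
        = c ^ 2 / 2 * ∑ i, ∑ j, b x i j * ∫ y, y i * y j ∂μ := by
      simp only [e2]
      rw [integral_const_mul, integral_finsetSum _ fun i _ ↦ integrable_finsetSum _ fun j _ ↦
        (int2 i j).const_mul _, Finset.mul_sum, Finset.mul_sum]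
      refine Finset.sum_congr rfl fun i _ ↦ ?_
      rw [integral_finsetSum _ fun j _ ↦ (int2 i j).const_mul _, Finset.mul_sum, Finset.mul_sum]
      refine Finset.sum_congr rfl fun j _ ↦ ?_
      rw [integral_const_mul]
      ring
    rw [integral_add ints01 ints2,
      integral_add (integrable_const _) ints1, v1, v2]
    simp
  rw [← key, ← integral_sub intf intp, ← integral_const_mul, ← Real.norm_eq_abs]
  refine norm_integral_le_of_norm_le (int3.const_mul _) (ae_of_all _ fun y ↦ ?_)
  refine (hf.abs_remainder_le x (c • y)).trans_eq ?_
  rw [norm_smul, Real.norm_of_nonneg hc]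
  ring

/-- Replacing a small Gaussian increment by a more correlated one can decrease the expectation
only by a third order term. -/
lemma HasSlepianExpansion.integral_le_integral_add {ι : Type*} [Fintype ι] {f : (ι → ℝ) → ℝ}
    {a : (ι → ℝ) → ι → ℝ} {b : (ι → ℝ) → ι → ι → ℝ} {C : ℝ}
    (hf : HasSlepianExpansion f a b C) (μ ν : Measure (ι → ℝ)) [IsProbabilityMeasure μ]
    [IsProbabilityMeasure ν] (hμ : MemLp id 3 μ) (hν : MemLp id 3 ν)
    (hμ0 : ∀ i, ∫ y, y i ∂μ = 0) (hν0 : ∀ i, ∫ y, y i ∂ν = 0)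
    (hvar : ∀ i, ∫ y, y i * y i ∂μ = ∫ y, y i * y i ∂ν)
    (hcov : ∀ i j, ∫ y, y i * y j ∂μ ≤ ∫ y, y i * y j ∂ν) (x : ι → ℝ) {c : ℝ} (hc : 0 ≤ c) :
    ∫ y, f (x + c • y) ∂μ ≤ ∫ y, f (x + c • y) ∂ν
      + C * c ^ 3 * (∫ y, ‖y‖ ^ 3 ∂μ + ∫ y, ‖y‖ ^ 3 ∂ν) := by
  have h1 := (abs_le.1 (hf.abs_integral_sub_le μ hμ hμ0 x hc)).2
  have h2 := (abs_le.1 (hf.abs_integral_sub_le ν hν hν0 x hc)).1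
  have h3 : ∑ i, ∑ j, b x i j * ∫ y, y i * y j ∂μ ≤ ∑ i, ∑ j, b x i j * ∫ y, y i * y j ∂ν := by
    refine Finset.sum_le_sum fun i _ ↦ Finset.sum_le_sum fun j _ ↦ ?_
    rcases eq_or_ne i j with rfl | hij
    · rw [hvar]
    · exact mul_le_mul_of_nonneg_left (hcov i j) (hf.hessian_nonneg x i j hij)
  have h4 := mul_le_mul_of_nonneg_left h3 (by positivity : 0 ≤ c ^ 2 / 2)
  linarith

/-- The law of `√t • X` when `X` has law `μ`. -/
noncomputable def sqrtScale {ι : Type*} (μ : Measure (ι → ℝ)) (t : ℝ) : Measure (ι → ℝ) :=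
  μ.map (fun x ↦ √t • x)

section sqrtScale

variable {ι : Type*}

instance (μ : Measure (ι → ℝ)) [IsProbabilityMeasure μ] (t : ℝ) :
    IsProbabilityMeasure (sqrtScale μ t) :=
  Measure.isProbabilityMeasure_map (by fun_prop)

lemma sqrtScale_zero (μ : Measure (ι → ℝ)) [IsProbabilityMeasure μ] :
    sqrtScale μ 0 = Measure.dirac 0 := by
  simp [sqrtScale]

lemma sqrtScale_one (μ : Measure (ι → ℝ)) : sqrtScale μ 1 = μ := by
  simp [sqrtScale]

variable [Fintype ι]

lemma charFunDual_sqrtScale (μ : Measure (ι → ℝ)) [IsGaussian μ]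
    (h0 : ∀ L : StrongDual ℝ (ι → ℝ), ∫ x, L x ∂μ = 0) {t : ℝ} (ht : 0 ≤ t)
    (L : StrongDual ℝ (ι → ℝ)) :
    charFunDual (sqrtScale μ t) L = Complex.exp (-(t * Var[L; μ] / 2 : ℝ)) := by
  have e : sqrtScale μ t = μ.map (√t • ContinuousLinearMap.id ℝ (ι → ℝ)) := rfl
  have e2 : L.comp (√t • ContinuousLinearMap.id ℝ (ι → ℝ)) = √t • L := by ext; simp
  have e3 : Var[(√t • L : StrongDual ℝ (ι → ℝ)); μ] = t * Var[L; μ] := by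
    rw [FunLike.coe_smul, variance_smul, Real.sq_sqrt ht]
  rw [e, charFunDual_map, e2, IsGaussian.charFunDual_eq, e3, integral_complex_ofReal, h0]
  congr 1
  push_cast
  ring

lemma sqrtScale_conv_sqrtScale (μ : Measure (ι → ℝ)) [IsGaussian μ]
    (h0 : ∀ L : StrongDual ℝ (ι → ℝ), ∫ x, L x ∂μ = 0) {s t : ℝ} (hs : 0 ≤ s) (ht : 0 ≤ t) :
    sqrtScale μ s ∗ sqrtScale μ t = sqrtScale μ (s + t) := by
  refine Measure.ext_of_charFunDual (funext fun L ↦ ?_)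
  rw [charFunDual_conv, charFunDual_sqrtScale μ h0 hs, charFunDual_sqrtScale μ h0 ht,
    charFunDual_sqrtScale μ h0 (add_nonneg hs ht), ← Complex.exp_add]
  congr 1
  push_cast
  ring

lemma integral_conv_sqrtScale {f : (ι → ℝ) → ℝ} {C : ℝ} (hf : Continuous f)
    (hC : ∀ x, |f x| ≤ C) (m μ : Measure (ι → ℝ)) [IsProbabilityMeasure m]
    [IsProbabilityMeasure μ] (t : ℝ) :
    ∫ x, f x ∂(m ∗ sqrtScale μ t) = ∫ x, ∫ y, f (x + √t • y) ∂μ ∂m := by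
  rw [integral_conv (Integrable.of_bound hf.aestronglyMeasurable C (ae_of_all _ hC))]
  congr 1 with x
  rw [sqrtScale, integral_map (by fun_prop)]
  exact (hf.comp (by fun_prop)).aestronglyMeasurable

/-- Slepian comparison of the expectations of a function with a Slepian expansion. -/
lemma HasSlepianExpansion.integral_le_integral {f : (ι → ℝ) → ℝ}
    {a : (ι → ℝ) → ι → ℝ} {b : (ι → ℝ) → ι → ι → ℝ} {C : ℝ}
    (hf : HasSlepianExpansion f a b C) (μ ν : Measure (ι → ℝ)) [IsGaussian μ] [IsGaussian ν]
    (hμ0 : ∀ L : StrongDual ℝ (ι → ℝ), ∫ x, L x ∂μ = 0)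
    (hν0 : ∀ L : StrongDual ℝ (ι → ℝ), ∫ x, L x ∂ν = 0)
    (hvar : ∀ i, ∫ y, y i * y i ∂μ = ∫ y, y i * y i ∂ν)
    (hcov : ∀ i j, ∫ y, y i * y j ∂μ ≤ ∫ y, y i * y j ∂ν) :
    ∫ x, f x ∂μ ≤ ∫ x, f x ∂ν := by
  have hfC (x) : |f x| ≤ C := by rw [abs_of_nonneg (hf.nonneg x)]; exact hf.le_bound x
  set M := C * (∫ y, ‖y‖ ^ 3 ∂μ + ∫ y, ‖y‖ ^ 3 ∂ν) with hM
  let I (s t : ℝ) : ℝ := ∫ x, f x ∂(sqrtScale μ s ∗ sqrtScale ν t)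
  have step {s t d : ℝ} (hs : 0 ≤ s) (ht : 0 ≤ t) (hd : 0 ≤ d) :
      I (s + d) t ≤ I s (t + d) + M * √d ^ 3 := by
    let m := sqrtScale μ s ∗ sqrtScale ν t
    have e1 : I (s + d) t = ∫ x, ∫ y, f (x + √d • y) ∂μ ∂m := by
      rw [← integral_conv_sqrtScale hf.continuous hfC, Measure.conv_assoc,
        Measure.conv_comm (sqrtScale ν t), ← Measure.conv_assoc,
        sqrtScale_conv_sqrtScale μ hμ0 hs hd]
    have e2 : I s (t + d) = ∫ x, ∫ y, f (x + √d • y) ∂ν ∂m := by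
      rw [← integral_conv_sqrtScale hf.continuous hfC, Measure.conv_assoc,
        sqrtScale_conv_sqrtScale ν hν0 ht hd]
    have hint (ρ : Measure (ι → ℝ)) [IsProbabilityMeasure ρ] :
        Integrable (fun x ↦ ∫ y, f (x + √d • y) ∂ρ) m := by
      refine Integrable.of_bound (C := C) ?_ (ae_of_all _ fun x ↦ ?_)
      · exact (StronglyMeasurable.integral_prod_right (f := fun x y ↦ f (x + √d • y))
          (hf.continuous.comp (by fun_prop)).stronglyMeasurable).aestronglyMeasurable
      · simpa using norm_integral_le_of_norm_le_const (μ := ρ)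
          (f := fun y ↦ f (x + √d • y)) (ae_of_all _ fun y ↦ hfC (x + √d • y))
    have e3 : I s (t + d) + M * √d ^ 3 = ∫ x, (∫ y, f (x + √d • y) ∂ν + M * √d ^ 3) ∂m := by
      rw [integral_add (hint ν) (integrable_const _), e2]
      simp
    rw [e1, e3]
    refine integral_mono (hint μ) ((hint ν).add (integrable_const _)) fun x ↦ ?_
    refine (hf.integral_le_integral_add μ ν (IsGaussian.memLp_id μ 3 (by simp))
      (IsGaussian.memLp_id ν 3 (by simp)) (fun i ↦ hμ0 (ContinuousLinearMap.proj i))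
      (fun i ↦ hν0 (ContinuousLinearMap.proj i)) hvar hcov x (Real.sqrt_nonneg d)).trans_eq ?_
    rw [hM]
    ring
  have bound (N : ℕ) : ∫ x, f x ∂μ ≤ ∫ x, f x ∂ν + M * √(1 / (N + 1 : ℝ)) := by
    set d : ℝ := 1 / (N + 1 : ℝ) with hd
    have hd0 : 0 ≤ d := by positivity
    have iter (k l : ℕ) : I ((k + l : ℕ) * d) 0 ≤ I (l * d) (k * d) + k * (M * √d ^ 3) := by
      induction k generalizing l with
      | zero => simp
      | succ k ih =>
        have h1 := ih (l + 1)
        have h2 := step (s := l * d) (t := k * d) (by positivity) (by positivity) hd0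
        have e1 : l * d + d = ((l + 1 : ℕ) : ℝ) * d := by push_cast; ring
        have e2 : k * d + d = ((k + 1 : ℕ) : ℝ) * d := by push_cast; ring
        rw [e1, e2] at h2
        rw [show k + 1 + l = k + (l + 1) by ring]
        refine h1.trans ((add_le_add_left h2 _).trans_eq ?_)
        push_cast
        ring
    have h := iter (N + 1) 0
    have hNd : ((N + 1 : ℕ) : ℝ) * d = 1 := by
      rw [hd]; push_cast; field_simp
    have e : ((N + 1 : ℕ) : ℝ) * (M * √d ^ 3) = M * √d := by
      have : √d ^ 3 = d * √d := by rw [pow_succ, Real.sq_sqrt hd0]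
      rw [this, show ((N + 1 : ℕ) : ℝ) * (M * (d * √d)) = (((N + 1 : ℕ) : ℝ) * d) * (M * √d) by
        ring, hNd, one_mul]
    rw [e, add_zero, hNd] at h
    simpa [I, sqrtScale_zero, sqrtScale_one] using h
  have lim : Tendsto (fun N : ℕ ↦ ∫ x, f x ∂ν + M * √(1 / (N + 1 : ℝ))) atTop
      (𝓝 (∫ x, f x ∂ν + M * √0)) :=
    ((Real.continuous_sqrt.tendsto 0).comp tendsto_one_div_add_atTop_nhds_zero_nat).const_mul M
      |>.const_add _
  simpa using ge_of_tendsto' lim bound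

end sqrtScale

lemma hasCompactSupport_deriv_smoothTransition_comp (c r : ℝ) (hc : 0 < c) :
    HasCompactSupport (deriv fun x ↦ Real.smoothTransition (c * (r - x))) := by
  refine HasCompactSupport.intro (isCompact_Icc (a := r - 1 / c) (b := r)) fun x hx ↦ ?_
  rw [mem_Icc, not_and_or, not_le, not_le] at hx
  rcases hx with hx | hx
  · have : (fun x ↦ Real.smoothTransition (c * (r - x))) =ᶠ[𝓝 x] fun _ ↦ 1 := by
      filter_upwards [Iio_mem_nhds hx] with y hy
      refine Real.smoothTransition.one_of_one_le ?_
      have h1 : 1 / c ≤ r - y := by linarith [mem_Iio.1 hy]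
      have h2 := mul_le_mul_of_nonneg_left h1 hc.le
      rwa [mul_one_div_cancel hc.ne'] at h2
    rw [this.deriv_eq, deriv_const]
  · have : (fun x ↦ Real.smoothTransition (c * (r - x))) =ᶠ[𝓝 x] fun _ ↦ 0 := by
      filter_upwards [Ioi_mem_nhds hx] with y hy
      exact Real.smoothTransition.zero_of_nonpos
        (mul_nonpos_of_nonneg_of_nonpos hc.le (by linarith [mem_Ioi.1 hy]))
    rw [this.deriv_eq, deriv_const]

lemma tendsto_smoothTransition_indicator (r x : ℝ) :
    Tendsto (fun k : ℕ ↦ Real.smoothTransition ((k + 1 : ℝ) * (r - x))) atTop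
      (𝓝 ((Iio r).indicator 1 x)) := by
  rcases lt_or_ge x r with h | h
  · rw [indicator_of_mem (mem_Iio.2 h)]
    have h1 : Tendsto (fun k : ℕ ↦ (k + 1 : ℝ) * (r - x)) atTop atTop :=
      (tendsto_atTop_add_const_right _ _ tendsto_natCast_atTop_atTop).atTop_mul_const
        (sub_pos.2 h)
    refine tendsto_const_nhds.congr' ?_
    filter_upwards [h1.eventually_ge_atTop 1] with k hk
    exact (Real.smoothTransition.one_of_one_le hk).symm
  · rw [indicator_of_notMem (by simpa using h)]
    refine tendsto_const_nhds.congr fun k ↦ ?_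
    exact (Real.smoothTransition.zero_of_nonpos
      (mul_nonpos_of_nonneg_of_nonpos (by positivity) (by linarith))).symm

/-- Slepian comparison for the probabilities of lower orthants. -/
lemma measureReal_pi_Iio_le {ι : Type*} [Fintype ι] (μ ν : Measure (ι → ℝ))
    [IsGaussian μ] [IsGaussian ν]
    (hμ0 : ∀ L : StrongDual ℝ (ι → ℝ), ∫ x, L x ∂μ = 0)
    (hν0 : ∀ L : StrongDual ℝ (ι → ℝ), ∫ x, L x ∂ν = 0)
    (hvar : ∀ i, ∫ y, y i * y i ∂μ = ∫ y, y i * y i ∂ν)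
    (hcov : ∀ i j, ∫ y, y i * y j ∂μ ≤ ∫ y, y i * y j ∂ν) (r : ι → ℝ) :
    μ.real (univ.pi fun i ↦ Iio (r i)) ≤ ν.real (univ.pi fun i ↦ Iio (r i)) := by
  let f (k : ℕ) (x : ι → ℝ) : ℝ := ∏ i, Real.smoothTransition ((k + 1 : ℝ) * (r i - x i))
  have expansion (k : ℕ) : ∃ a b C, HasSlepianExpansion (f k) a b C := by
    refine HasSlepianExpansion.exists_prod _ fun i ↦
      HasSlepianExpansion.exists_comp_apply
        (φ := fun x ↦ Real.smoothTransition ((k + 1 : ℝ) * (r i - x)))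
        (Real.smoothTransition.contDiff.comp (by fun_prop))
        (hasCompactSupport_deriv_smoothTransition_comp _ _ (by positivity))
        (fun x y hxy ↦ Real.smoothTransition.monotone (by gcongr))
        (fun _ ↦ Real.smoothTransition.nonneg _) (fun _ ↦ Real.smoothTransition.le_one _) i
  have hs : MeasurableSet (univ.pi fun i ↦ Iio (r i)) :=
    MeasurableSet.univ_pi fun _ ↦ measurableSet_Iio
  have lim (ρ : Measure (ι → ℝ)) [IsProbabilityMeasure ρ] :
      Tendsto (fun k ↦ ∫ x, f k x ∂ρ) atTop (𝓝 (ρ.real (univ.pi fun i ↦ Iio (r i)))) := by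
    rw [← integral_indicator_one hs]
    refine tendsto_integral_of_dominated_convergence (fun _ ↦ 1) (fun k ↦ ?_)
      (integrable_const _) (fun k ↦ ae_of_all _ fun x ↦ ?_) (ae_of_all _ fun x ↦ ?_)
    · obtain ⟨a, b, C, h⟩ := expansion k
      exact h.continuous.aestronglyMeasurable
    · rw [Real.norm_of_nonneg (Finset.prod_nonneg fun _ _ ↦ Real.smoothTransition.nonneg _)]
      exact Finset.prod_le_one (fun _ _ ↦ Real.smoothTransition.nonneg _)
        (fun _ _ ↦ Real.smoothTransition.le_one _)
    · have e : (univ.pi fun i ↦ Iio (r i)).indicator (1 : (ι → ℝ) → ℝ) x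
          = ∏ i, (Iio (r i)).indicator 1 (x i) := by
        by_cases hx : x ∈ univ.pi fun i ↦ Iio (r i)
        · rw [indicator_of_mem hx]
          exact (Finset.prod_eq_one fun i _ ↦ indicator_of_mem (hx i (mem_univ i)) _).symm
        · rw [indicator_of_notMem hx]
          simp only [mem_univ_pi, not_forall] at hx
          obtain ⟨i, hi⟩ := hx
          exact (Finset.prod_eq_zero (Finset.mem_univ i) (indicator_of_notMem hi _)).symm
      rw [e]
      exact tendsto_finsetProd _ fun i _ ↦ tendsto_smoothTransition_indicator (r i) (x i)
  refine le_of_tendsto_of_tendsto' (lim μ) (lim ν) fun k ↦ ?_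
  obtain ⟨a, b, C, h⟩ := expansion k
  exact h.integral_le_integral μ ν hμ0 hν0 hvar hcov

lemma map_map_strongDual_eq_gaussianReal {Ω ι : Type*} [MeasurableSpace Ω] [Fintype ι]
    {μ : Measure Ω} {U : ι → Ω → ℝ} (hU : ∀ j, Measurable (U j))
    (hG : ∀ c : ι → ℝ, ∃ v : NNReal,
      μ.map (fun ω ↦ ∑ j, c j * U j ω) = gaussianReal 0 v) (L : StrongDual ℝ (ι → ℝ)) :
    ∃ v : NNReal, (μ.map fun ω j ↦ U j ω).map L = gaussianReal 0 v := by
  classical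
  obtain ⟨v, hv⟩ := hG fun j ↦ L (Pi.single j 1)
  refine ⟨v, ?_⟩
  rw [Measure.map_map (by fun_prop) (measurable_pi_lambda _ hU), ← hv]
  congr 1 with ω
  refine (L.toLinearMap.pi_apply_eq_sum_univ fun j ↦ U j ω).trans
    (Finset.sum_congr rfl fun j _ ↦ ?_)
  rw [smul_eq_mul, mul_comm, ContinuousLinearMap.coe_coe]
  congr 2
  ext i
  simp [Pi.single_apply, eq_comm]

lemma integral_strongDual_map_eq_zero {ι : Type*} [Fintype ι] {μ : Measure (ι → ℝ)}
    {L : StrongDual ℝ (ι → ℝ)} {v : NNReal} (h : μ.map L = gaussianReal 0 v) :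
    ∫ x, L x ∂μ = 0 := by
  have e : ∫ x, x ∂(μ.map L) = ∫ x, L x ∂μ :=
    integral_map (by fun_prop) aestronglyMeasurable_id
  rw [← e, h, integral_id_gaussianReal]

/-- Generalized Slepian inequality: under the Slepian comparison assumptions, for all
positive levels `r₁, …, rₙ`, `P(∃ j, U_j ≥ r_j) ≥ P(∃ j, V_j ≥ r_j)`. -/
theorem slepian_inequality_general {Ω₁ Ω₂ : Type*} [MeasurableSpace Ω₁] [MeasurableSpace Ω₂]
    (μ : Measure Ω₁) (ν : Measure Ω₂)
    [IsProbabilityMeasure μ] [IsProbabilityMeasure ν]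
    (n : ℕ) (hn : 1 ≤ n) (U : Fin n → Ω₁ → ℝ) (V : Fin n → Ω₂ → ℝ)
    (hUm : ∀ j, Measurable (U j)) (hVm : ∀ j, Measurable (V j))
    (hUgauss : ∀ c : Fin n → ℝ, ∃ v : NNReal,
      Measure.map (fun ω => ∑ j, c j * U j ω) μ = gaussianReal 0 v)
    (hVgauss : ∀ c : Fin n → ℝ, ∃ v : NNReal,
      Measure.map (fun ω => ∑ j, c j * V j ω) ν = gaussianReal 0 v)
    (hvar : ∀ j, ∫ ω, (U j ω) ^ 2 ∂μ = ∫ ω, (V j ω) ^ 2 ∂ν)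
    (hcov : ∀ i j, ∫ ω, U i ω * U j ω ∂μ ≤ ∫ ω, V i ω * V j ω ∂ν)
    (r : Fin n → ℝ) (hr : ∀ j, 0 < r j) :
    ν {ω | ∃ j, r j ≤ V j ω} ≤ μ {ω | ∃ j, r j ≤ U j ω} := by
  have hU : Measurable fun ω j ↦ U j ω := measurable_pi_lambda _ hUm
  have hV : Measurable fun ω j ↦ V j ω := measurable_pi_lambda _ hVm
  have hUL := map_map_strongDual_eq_gaussianReal hUm hUgauss
  have hVL := map_map_strongDual_eq_gaussianReal hVm hVgauss
  have : IsGaussian (μ.map fun ω j ↦ U j ω) :=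
    isGaussian_of_map_eq_gaussianReal fun L ↦ ⟨0, hUL L⟩
  have : IsGaussian (ν.map fun ω j ↦ V j ω) :=
    isGaussian_of_map_eq_gaussianReal fun L ↦ ⟨0, hVL L⟩
  have covU (i j : Fin n) : ∫ y, y i * y j ∂(μ.map fun ω j ↦ U j ω) = ∫ ω, U i ω * U j ω ∂μ :=
    integral_map hU.aemeasurable (by fun_prop)
  have covV (i j : Fin n) : ∫ y, y i * y j ∂(ν.map fun ω j ↦ V j ω) = ∫ ω, V i ω * V j ω ∂ν :=
    integral_map hV.aemeasurable (by fun_prop)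
  have key := measureReal_pi_Iio_le (μ.map fun ω j ↦ U j ω) (ν.map fun ω j ↦ V j ω)
    (fun L ↦ integral_strongDual_map_eq_zero (hUL L).choose_spec)
    (fun L ↦ integral_strongDual_map_eq_zero (hVL L).choose_spec)
    (fun i ↦ by rw [covU, covV]; simpa only [sq] using hvar i)
    (fun i j ↦ by rw [covU, covV]; exact hcov i j) r
  have hs : MeasurableSet (univ.pi fun i ↦ Iio (r i)) :=
    MeasurableSet.univ_pi fun _ ↦ measurableSet_Iio
  rw [measureReal_def, measureReal_def, ENNReal.toReal_le_toReal (measure_ne_top _ _)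
    (measure_ne_top _ _), Measure.map_apply hU hs, Measure.map_apply hV hs] at key
  have eU : {ω | ∃ j, r j ≤ U j ω} = ((fun ω j ↦ U j ω) ⁻¹' univ.pi fun i ↦ Iio (r i))ᶜ := by
    ext ω; simp
  have eV : {ω | ∃ j, r j ≤ V j ω} = ((fun ω j ↦ V j ω) ⁻¹' univ.pi fun i ↦ Iio (r i))ᶜ := by
    ext ω; simp
  rw [eU, eV, prob_compl_eq_one_sub (hU hs), prob_compl_eq_one_sub (hV hs)]
  exact tsub_le_tsub_left key 1
end
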